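/- Let q > 1 and define the big q-Jacobi polynomial P^m_l(x) = Σ_{k=0}^{l−m} (−1)^k q^{−k(m+1)} (x;q⁻²)_k / (−q^{−2(m+1)};q⁻²)_k · [l−m choose k]_q [l+m+k choose k]_q [m+k choose k]_q⁻¹ for integers 0 ≤ m ≤ l, where (a;p)_k = Π_{n=0}^{k−1}(1−ap^n) and [n choose k]_q is the symmetric q-binomial coefficient formed from [a] = (q^a − q^{−a})/(q − q⁻¹). Then P^m_l is a polynomial in x of degree exactly l − m, and P^m_l(−x) = (−1)^{l−m} P^m_l(x). -/

import Mathlib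

noncomputable section

/-- Symmetric q-number [a] = (q^a − q^{−a})/(q − q⁻¹). -/
def qNum (q : ℝ) (a : ℤ) : ℝ := (q ^ a - q ^ (-a)) / (q - q⁻¹)

/-- Symmetric q-factorial [n]! = ∏_{k=1}^n [k]. -/
def qFact (q : ℝ) (n : ℕ) : ℝ := ∏ k ∈ Finset.range n, qNum q (k + 1)

/-- Symmetric q-binomial coefficient, zero unless 0 ≤ k ≤ n. -/
def qBinom (q : ℝ) (n k : ℤ) : ℝ :=
  if 0 ≤ k ∧ k ≤ n then qFact q n.toNat / (qFact q k.toNat * qFact q (n - k).toNat)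
  else 0

/-- q-Pochhammer symbol (a;p)_k = ∏_{n=0}^{k−1}(1 − a p^n). -/
def qPoch (a p : ℝ) (k : ℕ) : ℝ := ∏ n ∈ Finset.range k, (1 - a * p ^ n)

/-- (x;p)_k as a polynomial in x. -/
def qPochPoly (p : ℝ) (k : ℕ) : Polynomial ℝ :=
  ∏ n ∈ Finset.range k, (1 - Polynomial.C (p ^ n) * Polynomial.X)

/-- The big q-Jacobi polynomial
P^m_l(x) = Σ_{k=0}^{l−m} (−1)^k q^{−k(m+1)} (x;q⁻²)_k/(−q^{−2(m+1)};q⁻²)_k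
  [l−m choose k][l+m+k choose k][m+k choose k]⁻¹.
(It vanishes identically for l < m, since then [l−m choose k] = 0.) -/
def qJacobi (q : ℝ) (l m : ℕ) : Polynomial ℝ :=
  ∑ k ∈ Finset.range (l - m + 1),
    Polynomial.C ((-1 : ℝ) ^ k * q ^ (-(k : ℤ) * ((m : ℤ) + 1)) /
        qPoch (-(q ^ (-2 * ((m : ℤ) + 1)))) (q ^ (-2 : ℤ)) k *
      (qBinom q ((l : ℤ) - (m : ℤ)) k * qBinom q ((l : ℤ) + (m : ℤ) + k) k /
        qBinom q ((m : ℤ) + k) k)) *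
    qPochPoly (q ^ (-2 : ℤ)) k

open Polynomial

/-- Coefficient of `(x;q⁻²)_k` in `qJacobi q l m`. -/
def qJacobiCoeff (q : ℝ) (l m k : ℕ) : ℝ :=
  (-1 : ℝ) ^ k * q ^ (-(k : ℤ) * ((m : ℤ) + 1)) /
      qPoch (-(q ^ (-2 * ((m : ℤ) + 1)))) (q ^ (-2 : ℤ)) k *
    (qBinom q ((l : ℤ) - (m : ℤ)) k * qBinom q ((l : ℤ) + (m : ℤ) + k) k /
      qBinom q ((m : ℤ) + k) k)

lemma qJacobi_eq_sum (q : ℝ) (l m : ℕ) :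
    qJacobi q l m =
      ∑ k ∈ Finset.range (l - m + 1), C (qJacobiCoeff q l m k) * qPochPoly (q ^ (-2 : ℤ)) k :=
  rfl

lemma qNum_pos {q : ℝ} (hq : 1 < q) {n : ℤ} (hn : 0 < n) : 0 < qNum q n := by
  have h1 : q ^ (-n) < q ^ n := zpow_lt_zpow_right₀ hq (by omega)
  have h2 : q⁻¹ < q := (inv_lt_one_of_one_lt₀ hq).trans hq
  exact div_pos (sub_pos.2 h1) (sub_pos.2 h2)

lemma qFact_succ (q : ℝ) (n : ℕ) : qFact q (n + 1) = qFact q n * qNum q (n + 1) :=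
  Finset.prod_range_succ _ _

lemma qFact_pos {q : ℝ} (hq : 1 < q) (n : ℕ) : 0 < qFact q n :=
  Finset.prod_pos fun _ _ => qNum_pos hq (by positivity)

lemma qBinom_add (q : ℝ) (n k : ℕ) :
    qBinom q ((n : ℤ) + k) k = qFact q (n + k) / (qFact q k * qFact q n) := by
  rw [qBinom, if_pos (by omega), add_sub_cancel_right, Int.toNat_natCast, Int.toNat_natCast,
    ← Nat.cast_add, Int.toNat_natCast]

lemma qPoch_pos_of_neg {a p : ℝ} (ha : 0 ≤ a) (hp : 0 ≤ p) (k : ℕ) : 0 < qPoch (-a) p k :=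
  Finset.prod_pos fun n _ => by
    have : 0 ≤ a * p ^ n := by positivity
    linarith

lemma qJacobiCoeff_eq (q : ℝ) (m j k : ℕ) :
    qJacobiCoeff q (m + (j + k)) m k =
      (-1 : ℝ) ^ k * q ^ (-(k : ℤ) * ((m : ℤ) + 1)) /
        qPoch (-(q ^ (-2 * ((m : ℤ) + 1)))) (q ^ (-2 : ℤ)) k *
      (qFact q (j + k) / (qFact q k * qFact q j) *
        (qFact q (m + (j + k) + m + k) / (qFact q k * qFact q (m + (j + k) + m))) /
        (qFact q (m + k) / (qFact q k * qFact q m))) := by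
  rw [qJacobiCoeff, ← qBinom_add, ← qBinom_add, ← qBinom_add]
  congr 4
  all_goals push_cast; ring

lemma qJacobiCoeff_ne_zero {q : ℝ} (hq : 1 < q) (m j k : ℕ) :
    qJacobiCoeff q (m + (j + k)) m k ≠ 0 := by
  have hq0 : 0 < q := by linarith
  have hF n := (qFact_pos hq n).ne'
  have hP := (qPoch_pos_of_neg (zpow_nonneg hq0.le (-2 * ((m : ℤ) + 1)))
    (zpow_nonneg hq0.le (-2)) k).ne'
  rw [qJacobiCoeff_eq]
  exact mul_ne_zero (div_ne_zero (mul_ne_zero (by simp) (zpow_ne_zero _ hq0.ne')) hP)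
    (by simp [hF])

/-- Two-term recursion of the coefficients in terms of `q`-numbers. -/
lemma qJacobiCoeff_succ {q : ℝ} (hq : 1 < q) (m j k : ℕ) :
    qJacobiCoeff q (m + (j + 1 + k)) m (k + 1) *
        ((1 + q ^ (-2 * ((m : ℤ) + 1)) * (q ^ (-2 : ℤ)) ^ k) * q ^ ((m : ℤ) + 1) *
          qNum q (k + 1) * qNum q (m + k + 1)) =
      -qJacobiCoeff q (m + (j + 1 + k)) m k *
        (qNum q (j + 1) * qNum q (2 * m + j + 2 * k + 2)) := by
  have hq0 : 0 < q := by linarith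
  have hF n := (qFact_pos hq n).ne'
  have hP := (qPoch_pos_of_neg (zpow_nonneg hq0.le (-2 * ((m : ℤ) + 1)))
    (zpow_nonneg hq0.le (-2)) k).ne'
  have hf : 1 + q ^ (-2 * ((m : ℤ) + 1)) * (q ^ (-2 : ℤ)) ^ k ≠ 0 := by positivity
  have hk : qNum q (k + 1) ≠ 0 := (qNum_pos hq (by positivity)).ne'
  have hj : qNum q (j + 1) ≠ 0 := (qNum_pos hq (by positivity)).ne'
  have hmk : qNum q (m + k + 1) ≠ 0 := (qNum_pos hq (by positivity)).ne'
  have hPs : qPoch (-(q ^ (-2 * ((m : ℤ) + 1)))) (q ^ (-2 : ℤ)) (k + 1) =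
      qPoch (-(q ^ (-2 * ((m : ℤ) + 1)))) (q ^ (-2 : ℤ)) k *
        (1 + q ^ (-2 * ((m : ℤ) + 1)) * (q ^ (-2 : ℤ)) ^ k) := by
    rw [qPoch, Finset.prod_range_succ, ← qPoch]; ring
  have hz : q ^ (-((k + 1 : ℕ) : ℤ) * ((m : ℤ) + 1)) =
      q ^ (-(k : ℤ) * ((m : ℤ) + 1)) / q ^ ((m : ℤ) + 1) := by
    rw [← zpow_sub₀ hq0.ne']; congr 1; push_cast; ring
  have hm : qFact q (m + (k + 1)) = qFact q (m + k) * qNum q (m + k + 1) := by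
    rw [← add_assoc, qFact_succ]; push_cast; rfl
  have hl : qFact q (m + (j + (k + 1)) + m + (k + 1)) =
      qFact q (m + (j + (k + 1)) + m + k) * qNum q (2 * m + j + 2 * k + 2) := by
    rw [← add_assoc _ k 1, qFact_succ]; congr 2; push_cast; ring
  have hjk : j + 1 + k = j + (k + 1) := by ring
  have e := qJacobiCoeff_eq q m (j + 1) k
  rw [hjk] at e ⊢
  rw [e, qJacobiCoeff_eq, hPs, hz, hm, hl, qFact_succ q k, qFact_succ q j, pow_succ]
  have hz1 : q ^ ((m : ℤ) + 1) ≠ 0 := by positivity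
  have hz2 : q ^ (-(k : ℤ) * ((m : ℤ) + 1)) ≠ 0 := by positivity
  generalize q ^ (-2 * ((m : ℤ) + 1)) * (q ^ (-2 : ℤ)) ^ k = u at *
  generalize qPoch (-(q ^ (-2 * ((m : ℤ) + 1)))) (q ^ (-2 : ℤ)) k = P at *
  generalize q ^ ((m : ℤ) + 1) = v at *
  generalize q ^ (-(k : ℤ) * ((m : ℤ) + 1)) = w at *
  generalize qNum q (k + 1) = n1 at *
  generalize qNum q (j + 1) = n2 at *
  generalize qNum q (m + k + 1) = n3 at *
  generalize qNum q (2 * m + j + 2 * k + 2) = n4 at *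
  have f1 := hF k
  have f2 := hF j
  have f3 := hF m
  have f4 := hF (m + k)
  have f5 := hF (m + (j + (k + 1)) + m)
  field_simp

/-- Eigenvalue of the second order `p`-difference operator on degree `n` polynomials. -/
def qJacobiEigen (a p : ℝ) (n : ℕ) : ℝ := (p⁻¹ ^ n - 1) + a ^ 2 / p * (p ^ n - 1)

/-- The second order `p`-difference operator having the big q-Jacobi polynomials as generalized
eigenvectors. -/
def qJacobiOp (a p : ℝ) (f : ℝ[X]) (x : ℝ) : ℝ :=
  a ^ 2 / p * (x ^ 2 - 1) * (f.eval (p * x) - f.eval x) +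
    (x ^ 2 - a ^ 2) * (f.eval (p⁻¹ * x) - f.eval x)

lemma qJacobiCoeff_mul_lowering {q : ℝ} (hq : 1 < q) {l m k : ℕ} (hk : k < l - m) :
    qJacobiCoeff q l m (k + 1) *
        (-(1 - (q ^ (-2 : ℤ)) ^ (k + 1)) * (q ^ (-2 : ℤ)) ^ k / q ^ (-2 : ℤ) *
          ((q ^ (-2 : ℤ))⁻¹ ^ (2 * k) - (q ^ (-2 * ((m : ℤ) + 1))) ^ 2)) =
      (qJacobiEigen (q ^ (-2 * ((m : ℤ) + 1))) (q ^ (-2 : ℤ)) (l - m) -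
        qJacobiEigen (q ^ (-2 * ((m : ℤ) + 1))) (q ^ (-2 : ℤ)) k) * qJacobiCoeff q l m k := by
  obtain ⟨j, rfl⟩ : ∃ j, l = m + (j + 1 + k) := ⟨l - m - k - 1, by omega⟩
  have hq0 : 0 < q := by linarith
  have hk1 : qNum q (k + 1) ≠ 0 := (qNum_pos hq (by positivity)).ne'
  have hmk : qNum q (m + k + 1) ≠ 0 := (qNum_pos hq (by positivity)).ne'
  have hf : 1 + q ^ (-2 * ((m : ℤ) + 1)) * (q ^ (-2 : ℤ)) ^ k ≠ 0 := by positivity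
  have hz1 : q ^ ((m : ℤ) + 1) ≠ 0 := by positivity
  have key := qJacobiCoeff_succ hq m j k
  have hsub : m + (j + 1 + k) - m = j + 1 + k := by omega
  rw [hsub]
  generalize qJacobiCoeff q (m + (j + 1 + k)) m (k + 1) = c1 at *
  generalize qJacobiCoeff q (m + (j + 1 + k)) m k = c0 at *
  rw [← eq_div_iff (by positivity)] at key
  rw [key]
  have hp : q ^ (-2 : ℤ) = (q ^ 2)⁻¹ := by rw [zpow_neg]; rfl
  have ha : q ^ (-2 * ((m : ℤ) + 1)) = ((q ^ m * q) ^ 2)⁻¹ := by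
    rw [← pow_succ, ← pow_mul, ← zpow_natCast, ← zpow_neg]; congr 1; push_cast; ring
  have e1 : q ^ ((m : ℤ) + 1) = q ^ m * q := by rw [zpow_add₀ hq0.ne']; simp
  have n1 : qNum q (k + 1) = (q ^ k * q - (q ^ k * q)⁻¹) / (q - q⁻¹) := by
    rw [qNum, zpow_neg, zpow_add₀ hq0.ne']; simp
  have n2 : qNum q (j + 1) = (q ^ j * q - (q ^ j * q)⁻¹) / (q - q⁻¹) := by
    rw [qNum, zpow_neg, zpow_add₀ hq0.ne']; simp
  have n3 : qNum q (m + k + 1) =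
      (q ^ m * q ^ k * q - (q ^ m * q ^ k * q)⁻¹) / (q - q⁻¹) := by
    rw [qNum, zpow_neg, zpow_add₀ hq0.ne', zpow_add₀ hq0.ne']; simp
  have n4 : qNum q (2 * m + j + 2 * k + 2) =
      ((q ^ m) ^ 2 * q ^ j * (q ^ k) ^ 2 * q ^ 2 -
        ((q ^ m) ^ 2 * q ^ j * (q ^ k) ^ 2 * q ^ 2)⁻¹) / (q - q⁻¹) := by
    have : q ^ (2 * m + j + 2 * k + 2 : ℤ) = (q ^ m) ^ 2 * q ^ j * (q ^ k) ^ 2 * q ^ 2 := by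
      rw [← pow_mul, ← pow_mul, ← pow_add, ← pow_add, ← pow_add, ← zpow_natCast]
      congr 1; push_cast; ring
    rw [qNum, zpow_neg, this]
  rw [qJacobiEigen, qJacobiEigen, ha, hp, e1, n1, n2, n3, n4]
  have p1 : (q ^ 2) ^ k = (q ^ k) ^ 2 := by ring
  have p2 : (q ^ 2) ^ j = (q ^ j) ^ 2 := by ring
  have p3 : (q ^ 2) ^ (2 * k) = (q ^ k) ^ 4 := by ring
  simp only [inv_inv, inv_pow, pow_add, pow_one, p1, p2, p3]
  have hA : 1 ≤ q ^ k := one_le_pow₀ hq.le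
  have hB : 1 ≤ q ^ m := one_le_pow₀ hq.le
  have hD : 1 ≤ q ^ j := one_le_pow₀ hq.le
  clear n1 n2 n3 n4 ha hp e1 p1 p2 p3 key hk1 hmk hf hz1 hsub
  generalize q ^ k = A at *
  generalize q ^ m = B at *
  generalize q ^ j = D at *
  have hA0 : 0 < A := by linarith
  have hB0 : 0 < B := by linarith
  have hD0 : 0 < D := by linarith
  have hAq : 1 < q * A := one_lt_mul_of_lt_of_le hq hA
  have hBAq : 1 < q * B * A := one_lt_mul_of_lt_of_le (one_lt_mul_of_lt_of_le hq hB) hA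
  have g0 : q ^ 2 - 1 ≠ 0 := (sub_pos.2 (one_lt_pow₀ hq two_ne_zero)).ne'
  have g1 : q ^ 2 * A ^ 2 - 1 ≠ 0 := by
    rw [← mul_pow]; exact (sub_pos.2 (one_lt_pow₀ hAq two_ne_zero)).ne'
  have g2 : q ^ 2 * B ^ 2 * A ^ 2 - 1 ≠ 0 := by
    rw [← mul_pow, ← mul_pow]; exact (sub_pos.2 (one_lt_pow₀ hBAq two_ne_zero)).ne'
  have g3 : B ^ 2 * q ^ 2 * A ^ 2 + 1 ≠ 0 := by positivity
  field_simp
  ring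

lemma eval_qPochPoly_succ (p : ℝ) (k : ℕ) (x : ℝ) :
    (qPochPoly p (k + 1)).eval x = (qPochPoly p k).eval x * (1 - p ^ k * x) := by
  simp [qPochPoly, Finset.prod_range_succ]

lemma eval_qPochPoly_succ' (p : ℝ) (k : ℕ) (x : ℝ) :
    (qPochPoly p (k + 1)).eval x = (1 - x) * (qPochPoly p k).eval (p * x) := by
  simp only [qPochPoly, Finset.prod_range_succ', eval_mul, eval_prod]
  simp only [eval_sub, eval_one, eval_C, eval_X, eval_mul, pow_zero, one_mul]
  rw [mul_comm]
  exact congrArg _ (Finset.prod_congr rfl fun _ _ => by ring)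

lemma qJacobiOp_qPochPoly_succ {a p : ℝ} (hp : p ≠ 0) (k : ℕ) (x : ℝ) :
    qJacobiOp a p (qPochPoly p (k + 1)) x =
      qJacobiEigen a p (k + 1) * x ^ 2 * (qPochPoly p (k + 1)).eval x +
        -(1 - p ^ (k + 1)) * p ^ k / p * (p⁻¹ ^ (2 * k) - a ^ 2) * x ^ 2 *
          (qPochPoly p k).eval x := by
  have h1 : (qPochPoly p (k + 1)).eval (p⁻¹ * x) = (1 - p⁻¹ * x) * (qPochPoly p k).eval x := by
    rw [eval_qPochPoly_succ', mul_inv_cancel_left₀ hp]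
  have h2 := (eval_qPochPoly_succ' p k x).symm.trans (eval_qPochPoly_succ p k x)
  rw [qJacobiOp, qJacobiEigen, h1, eval_qPochPoly_succ p k x, eval_qPochPoly_succ p k (p * x)]
  have hA : p ^ k ≠ 0 := pow_ne_zero _ hp
  have h3 : p ^ (2 * k) = (p ^ k) ^ 2 := by ring
  simp only [inv_pow, pow_succ p k, h3]
  generalize p ^ k = A at *
  generalize (qPochPoly p k).eval (p * x) = W at *
  generalize (qPochPoly p k).eval x = V at *
  field_simp
  linear_combination (-(A * a ^ 2 * (x + 1) * (1 - p * x * A))) * h2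

lemma qJacobiOp_sum {a p : ℝ} (hp : p ≠ 0) (c : ℕ → ℝ) (N n : ℕ) (hn : n ≤ N)
    (hc : ∀ k < N, c (k + 1) * (-(1 - p ^ (k + 1)) * p ^ k / p * (p⁻¹ ^ (2 * k) - a ^ 2)) =
      (qJacobiEigen a p N - qJacobiEigen a p k) * c k) (x : ℝ) :
    qJacobiOp a p (∑ k ∈ Finset.range (n + 1), C (c k) * qPochPoly p k) x =
      qJacobiEigen a p N * x ^ 2 *
          (∑ k ∈ Finset.range (n + 1), C (c k) * qPochPoly p k).eval x -
        (qJacobiEigen a p N - qJacobiEigen a p n) * x ^ 2 * (c n * (qPochPoly p n).eval x) := by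
  induction n with
  | zero => simp [qJacobiOp, qPochPoly, qJacobiEigen]
  | succ n ih =>
    have h1 := ih (by omega)
    have h2 := qJacobiOp_qPochPoly_succ (a := a) hp n x
    have h3 := hc n (by omega)
    rw [Finset.sum_range_succ]
    set S := ∑ k ∈ Finset.range (n + 1), C (c k) * qPochPoly p k
    have h4 : qJacobiOp a p (S + C (c (n + 1)) * qPochPoly p (n + 1)) x =
        qJacobiOp a p S x + c (n + 1) * qJacobiOp a p (qPochPoly p (n + 1)) x := by
      simp only [qJacobiOp, eval_add, eval_mul, eval_C]; ring
    rw [h4, h1, h2, eval_add, eval_mul, eval_C]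
    linear_combination x ^ 2 * (qPochPoly p n).eval x * h3

lemma qJacobiEigen_ne {a p : ℝ} (hp : 0 < p) (hp1 : p < 1) (ha : 0 ≤ a) (ha1 : a < 1)
    {n N : ℕ} (h : n < N) : qJacobiEigen a p N ≠ qJacobiEigen a p n := by
  obtain ⟨j, rfl⟩ : ∃ j, N = n + j + 1 := ⟨N - n - 1, by omega⟩
  have e : qJacobiEigen a p (n + j + 1) - qJacobiEigen a p n =
      p⁻¹ ^ (n + j + 1) * (1 - p ^ (j + 1)) * (1 - a ^ 2 * p ^ (2 * n + j)) := by
    have h3 : p ^ (2 * n) = (p ^ n) ^ 2 := by ring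
    simp only [qJacobiEigen, inv_pow, pow_add, pow_one, h3]
    field_simp
    ring
  have h1 : p ^ (j + 1) < 1 := pow_lt_one₀ hp.le hp1 (by omega)
  have h2 : p ^ (2 * n + j) ≤ 1 := pow_le_one₀ hp.le hp1.le
  have h3 : a ^ 2 < 1 := pow_lt_one₀ ha ha1 (by omega)
  have h4 : 0 < 1 - a ^ 2 * p ^ (2 * n + j) := by nlinarith [sq_nonneg a]
  have h5 : 0 < 1 - p ^ (j + 1) := by linarith
  rw [← sub_ne_zero, e]
  positivity

lemma eq_zero_of_qJacobiOp_eq {a p : ℝ} (hp : 0 < p) (hp1 : p < 1) (ha : 0 ≤ a) (ha1 : a < 1)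
    {N : ℕ} {f : ℝ[X]} (hf : f.degree < N)
    (h : ∀ x, qJacobiOp a p f x = qJacobiEigen a p N * x ^ 2 * f.eval x) : f = 0 := by
  by_contra h0
  have hd : f.natDegree < N := (natDegree_lt_iff_degree_lt h0).2 hf
  have hpoly : X ^ 2 * (C (qJacobiEigen a p N) * f - C (a ^ 2 / p) * (f.comp (C p * X) - f) -
        (f.comp (C p⁻¹ * X) - f)) =
      -(C (a ^ 2 / p) * (f.comp (C p * X) - f) + C (a ^ 2) * (f.comp (C p⁻¹ * X) - f)) := by
    refine Polynomial.funext fun x => ?_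
    have := h x
    rw [qJacobiOp] at this
    simp only [eval_mul, eval_sub, eval_add, eval_neg, eval_pow, eval_X, eval_C, eval_comp]
    linear_combination -this
  have hz : f.coeff (f.natDegree + 2) = 0 := coeff_eq_zero_of_natDegree_lt (by omega)
  have hco := congrArg (fun g => coeff g (f.natDegree + 2)) hpoly
  simp only [coeff_X_pow_mul, coeff_sub, coeff_add, coeff_neg, coeff_C_mul,
    comp_C_mul_X_coeff, hz] at hco
  have hne := qJacobiEigen_ne hp hp1 ha ha1 hd
  have : (qJacobiEigen a p N - qJacobiEigen a p f.natDegree) * f.coeff f.natDegree = 0 := by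
    rw [qJacobiEigen.eq_1 a p f.natDegree]
    linear_combination hco
  rcases mul_eq_zero.1 this with h1 | h1
  · exact hne (sub_eq_zero.1 h1)
  · exact h0 (leadingCoeff_eq_zero.1 h1)

lemma degree_qPochPoly {p : ℝ} (hp : p ≠ 0) (k : ℕ) : (qPochPoly p k).degree = k := by
  have h (n : ℕ) : (1 - C (p ^ n) * X : ℝ[X]).degree = 1 := by
    have : (1 - C (p ^ n) * X : ℝ[X]) = C (-p ^ n) * X + C 1 := by
      rw [C_neg, C_1]; ring
    rw [this, degree_linear (neg_ne_zero.2 (pow_ne_zero n hp))]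
  rw [qPochPoly, degree_prod, Finset.sum_congr rfl fun n _ => h n]
  simp

lemma degree_sum_qPochPoly {p : ℝ} (hp : p ≠ 0) (c : ℕ → ℝ) (N : ℕ) (hc : c N ≠ 0) :
    (∑ k ∈ Finset.range (N + 1), C (c k) * qPochPoly p k).degree = N := by
  have hN : (C (c N) * qPochPoly p N).degree = N := by
    rw [degree_C_mul hc, degree_qPochPoly hp]
  rw [Finset.sum_range_succ, degree_add_eq_right_of_degree_lt, hN]
  rw [hN, ← mem_degreeLT]
  refine Submodule.sum_mem _ fun k hk => mem_degreeLT.2 ?_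
  rw [← smul_eq_C_mul]
  refine (degree_smul_le _ _).trans_lt ?_
  rw [degree_qPochPoly hp]
  exact_mod_cast Finset.mem_range.1 hk

/-- for q > 1 and 0 ≤ m ≤ l, P^m_l is a polynomial of degree exactly
l − m and satisfies the parity property P^m_l(−x) = (−1)^{l−m} P^m_l(x). -/
theorem stmt10 (q : ℝ) (hq : 1 < q) (l m : ℕ) (hml : m ≤ l) :
    (qJacobi q l m).degree = ((l - m : ℕ) : WithBot ℕ) ∧
    ∀ x : ℝ, (qJacobi q l m).eval (-x) = (-1 : ℝ) ^ (l - m) * (qJacobi q l m).eval x := by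
  obtain ⟨N, rfl⟩ := Nat.exists_eq_add_of_le hml
  have hq0 : 0 < q := by linarith
  have hp : 0 < q ^ (-2 : ℤ) := by positivity
  have hp1 : q ^ (-2 : ℤ) < 1 := zpow_lt_one_of_neg₀ hq (by norm_num)
  have ha : 0 ≤ q ^ (-2 * ((m : ℤ) + 1)) := by positivity
  have ha1 : q ^ (-2 * ((m : ℤ) + 1)) < 1 := zpow_lt_one_of_neg₀ hq (by omega)
  have hop := qJacobiOp_sum (a := q ^ (-2 * ((m : ℤ) + 1))) hp.ne'
    (qJacobiCoeff q (m + N) m) _ _ le_rfl (fun k hk => qJacobiCoeff_mul_lowering hq hk)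
  have hdeg : (qJacobi q (m + N) m).degree = ((m + N - m : ℕ) : WithBot ℕ) := by
    rw [qJacobi_eq_sum]
    refine degree_sum_qPochPoly hp.ne' _ _ ?_
    simpa using qJacobiCoeff_ne_zero hq m 0 N
  refine ⟨hdeg, ?_⟩
  simp only [← qJacobi_eq_sum, sub_self, zero_mul, sub_zero] at hop
  generalize qJacobi q (m + N) m = P at *
  generalize m + N - m = M at *
  have hzero : P.comp (C (-1) * X) - C ((-1) ^ M) * P = 0 := by
    refine eq_zero_of_qJacobiOp_eq hp hp1 ha ha1 (N := M) ?_ fun x => ?_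
    · rw [degree_lt_iff_coeff_zero]
      intro n hn
      rw [coeff_sub, comp_C_mul_X_coeff, coeff_C_mul]
      rcases hn.eq_or_lt with rfl | hn
      · ring
      · rw [coeff_eq_zero_of_degree_lt (n := n) (by rw [hdeg]; exact_mod_cast hn)]
        ring
    · have h1 := hop x
      have h2 := hop (-x)
      simp only [qJacobiOp, eval_sub, eval_mul, eval_C, eval_comp, eval_X, neg_one_mul,
        mul_neg] at h1 h2 ⊢
      linear_combination h2 - (-1) ^ M * h1
  intro x
  have := congrArg (eval x) hzero
  simp only [eval_sub, eval_mul, eval_C, eval_comp, eval_X, neg_one_mul, eval_zero] at this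
  linarith
end
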